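/- Let G be a finite edge-weighted graph and let H be a subgraph of G that can be (s,t)-covered. If all edge weights of G are positive, then f(G; n) ≲ n^((4/3)s + 2t + |V(G) \ V(H)|); if all edge weights of G are nonzero, then g(G; n) ≲ n^((4/3)s + 2t + |V(G) \ V(H)|). -/

import Mathlib

open scoped InnerProductSpace

noncomputable section

/-- Points in the plane. -/
abbrev Pt2 : Type := EuclideanSpace ℝ (Fin 2)

/-- The set of distance `G`-configurations in a point set `E`, for a graph `G` with
edge-weight function `w`. -/
def distConfigs {V : Type*} (G : SimpleGraph V) (w : V → V → ℝ) (E : Finset Pt2) :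
    Set (V → Pt2) :=
  {φ | (∀ v, φ v ∈ E) ∧ Function.Injective φ ∧ ∀ u v, G.Adj u v → ‖φ u - φ v‖ = w u v}

/-- The set of dot product `G`-configurations in a point set `E`, for a graph `G` with
edge-weight function `w`. -/
def dpConfigs {V : Type*} (G : SimpleGraph V) (w : V → V → ℝ) (E : Finset Pt2) :
    Set (V → Pt2) :=
  {φ | (∀ v, φ v ∈ E) ∧ Function.Injective φ ∧ ∀ u v, G.Adj u v → ⟪φ u, φ v⟫_ℝ = w u v}

/-- Finitely many points in the plane together with graphs of continuous functions on intervals,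
any two of which meet at most once. -/
structure MonotoneArrangement (V ι : Type*) where
  X : V → ℝ
  Y : V → ℝ
  point_ext : ∀ {u v}, X u = X v → Y u = Y v → u = v
  dom : ι → Set ℝ
  fn : ι → ℝ → ℝ
  ordConnected : ∀ i, (dom i).OrdConnected
  cont : ∀ i, ContinuousOn (fn i) (dom i)
  inter : ∀ {i j x y}, x ∈ dom i → x ∈ dom j → y ∈ dom i → y ∈ dom j → x < y →
    fn i x = fn j x → fn i y = fn j y → i = j

namespace MonotoneArrangement

variable {V ι : Type*} (M : MonotoneArrangement V ι)

/-- The point `v` lies on the curve `i`. -/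
def Inc (v : V) (i : ι) : Prop := M.X v ∈ M.dom i ∧ M.fn i (M.X v) = M.Y v

/-- The triple `(a, i, b)` is an edge if `a` and `b` are consecutive points, from left to right,
on the curve `i`. -/
def IsEdge (e : V × ι × V) : Prop :=
  M.Inc e.1 e.2.1 ∧ M.Inc e.2.2 e.2.1 ∧ M.X e.1 < M.X e.2.2 ∧
    ∀ u, M.Inc u e.2.1 → M.X e.1 < M.X u → M.X e.2.2 ≤ M.X u

/-- Two edges on different curves cross if their interiors meet. -/
def Crosses (e g : V × ι × V) : Prop :=
  e.2.1 ≠ g.2.1 ∧ ∃ x, M.X e.1 < x ∧ x < M.X e.2.2 ∧ M.X g.1 < x ∧ x < M.X g.2.2 ∧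
    M.fn e.2.1 x = M.fn g.2.1 x

variable {M}

theorem Inc.eq {u v : V} {i : ι} (hu : M.Inc u i) (hv : M.Inc v i) (h : M.X u = M.X v) : u = v :=
  M.point_ext h (by rw [← hu.2, ← hv.2, h])

theorem IsEdge.mem_dom {e : V × ι × V} (he : M.IsEdge e) {x : ℝ} (h1 : M.X e.1 ≤ x)
    (h2 : x ≤ M.X e.2.2) : x ∈ M.dom e.2.1 :=
  (M.ordConnected _).out he.1.1 he.2.1.1 ⟨h1, h2⟩

theorem IsEdge.eq_of_src {e g : V × ι × V} (he : M.IsEdge e) (hg : M.IsEdge g)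
    (h1 : e.1 = g.1) (hi : e.2.1 = g.2.1) : e = g := by
  obtain ⟨a, i, b⟩ := e
  obtain ⟨a', i', b'⟩ := g
  simp only at h1 hi
  subst h1 hi
  have : b = b' := he.2.1.eq hg.2.1
    (le_antisymm (he.2.2.2 _ hg.2.1 hg.2.2.1) (hg.2.2.2 _ he.2.1 he.2.2.1))
  rw [this]

theorem IsEdge.eq_of_mem {e g : V × ι × V} (he : M.IsEdge e) (hg : M.IsEdge g)
    (hi : e.2.1 = g.2.1) {x : ℝ} (h1 : M.X e.1 < x) (h2 : x < M.X e.2.2) (h3 : M.X g.1 < x)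
    (h4 : x < M.X g.2.2) : e = g := by
  refine he.eq_of_src hg (he.1.eq (hi ▸ hg.1) ?_) hi
  apply le_antisymm
  · by_contra! h
    linarith [hg.2.2.2 _ (hi ▸ he.1) h]
  · by_contra! h
    linarith [he.2.2.2 _ (hi ▸ hg.1) h]

/-- Two edges with the same left endpoint that meet again coincide. -/
theorem IsEdge.eq_of_meet {e g : V × ι × V} (he : M.IsEdge e) (hg : M.IsEdge g)
    (h : e.1 = g.1) {x : ℝ} (h1 : M.X e.1 < x) (h2 : x ≤ M.X e.2.2)
    (h4 : x ≤ M.X g.2.2) (hx : M.fn e.2.1 x = M.fn g.2.1 x) : e = g := by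
  refine he.eq_of_src hg h (M.inter he.1.1 (h ▸ hg.1.1) (he.mem_dom h1.le h2)
    (hg.mem_dom (h ▸ h1.le) h4) h1 ?_ hx)
  have := hg.1.2
  rw [← h] at this
  rw [he.1.2, this]

theorem nonneg_of_ne_zero_on_Ioo {h : ℝ → ℝ} {l r x y : ℝ} (hc : ContinuousOn h (Set.Icc l r))
    (h0 : ∀ z ∈ Set.Ioo l r, h z ≠ 0) (hx : x ∈ Set.Icc l r) (hy : y ∈ Set.Icc l r)
    (hpos : 0 < h x) : 0 ≤ h y := by
  by_contra! hneg
  rcases lt_trichotomy x y with hxy | rfl | hxy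
  · obtain ⟨z, hz, hz0⟩ := intermediate_value_Ioo' hxy.le
      (hc.mono (Set.Icc_subset_Icc hx.1 hy.2)) ⟨hneg, hpos⟩
    exact h0 z ⟨hx.1.trans_lt hz.1, hz.2.trans_le hy.2⟩ hz0
  · linarith
  · obtain ⟨z, hz, hz0⟩ := intermediate_value_Ioo hxy.le
      (hc.mono (Set.Icc_subset_Icc hy.1 hx.2)) ⟨hneg, hpos⟩
    exact h0 z ⟨hy.1.trans_lt hz.1, hz.2.trans_le hx.2⟩ hz0

/-- Noncrossing edges do not change their vertical order. -/
theorem fn_le_of_lt {e g : V × ι × V} (he : M.IsEdge e) (hg : M.IsEdge g) (hne : e ≠ g)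
    (hc : ¬ M.Crosses e g) {x y : ℝ} (hx1 : M.X e.1 ≤ x) (hx2 : x ≤ M.X e.2.2)
    (hx3 : M.X g.1 ≤ x) (hx4 : x ≤ M.X g.2.2) (hy1 : M.X e.1 ≤ y) (hy2 : y ≤ M.X e.2.2)
    (hy3 : M.X g.1 ≤ y) (hy4 : y ≤ M.X g.2.2) (hlt : M.fn e.2.1 x < M.fn g.2.1 x) :
    M.fn e.2.1 y ≤ M.fn g.2.1 y := by
  have := nonneg_of_ne_zero_on_Ioo (h := fun z => M.fn g.2.1 z - M.fn e.2.1 z)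
    (l := max (M.X e.1) (M.X g.1)) (r := min (M.X e.2.2) (M.X g.2.2)) (x := x) (y := y)
    (((M.cont _).mono fun z hz => hg.mem_dom (le_trans (le_max_right _ _) hz.1)
      (hz.2.trans (min_le_right _ _))).sub
    ((M.cont _).mono fun z hz => he.mem_dom (le_trans (le_max_left _ _) hz.1)
      (hz.2.trans (min_le_left _ _)))) ?_ ⟨max_le hx1 hx3, le_min hx2 hx4⟩
      ⟨max_le hy1 hy3, le_min hy2 hy4⟩ (sub_pos.2 hlt)
  · exact sub_nonneg.1 this
  · rintro z ⟨hz1, hz2⟩ hz0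
    rw [max_lt_iff] at hz1
    rw [lt_min_iff] at hz2
    by_cases hi : e.2.1 = g.2.1
    · exact hne (he.eq_of_mem hg hi hz1.1 hz2.1 hz1.2 hz2.2)
    · exact hc ⟨hi, z, hz1.1, hz2.1, hz1.2, hz2.2, (sub_eq_zero.1 hz0).symm⟩

variable (M) in
/-- The point `w` lies in the closed region to the right of the common left endpoint of `e` and
`g`, above `e` and below `g`. -/
def InWedge (e g : V × ι × V) (w : V) : Prop :=
  M.X e.1 < M.X w ∧ M.X w ≤ M.X e.2.2 ∧ M.X w ≤ M.X g.2.2 ∧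
    M.fn e.2.1 (M.X w) ≤ M.Y w ∧ M.Y w ≤ M.fn g.2.1 (M.X w)

variable (M) in
/-- The edge `g` is the next one above `e` among the edges in `A` with the same left endpoint,
where heights are compared at the abscissa `m`. -/
def IsNext (A : Finset (V × ι × V)) (m : ℝ) (e g : V × ι × V) : Prop :=
  g ∈ A ∧ g.1 = e.1 ∧ M.fn e.2.1 m < M.fn g.2.1 m ∧
    ∀ k ∈ A, k.1 = e.1 → M.fn e.2.1 m < M.fn k.2.1 m → M.fn g.2.1 m ≤ M.fn k.2.1 m

variable (M) in
/-- The point `w` is a leftmost point of `S` in the wedge between `e` and `g`. -/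
def IsFirst (S : Finset V) (e g : V × ι × V) (w : V) : Prop :=
  M.InWedge e g w ∧ ∀ u ∈ S, M.InWedge e g u → M.X w ≤ M.X u

/-- The hypotheses on a plane graph drawn with monotone edges. The number `m v` lies between the
abscissa of `v` and all larger abscissae. -/
structure IsPlane (M : MonotoneArrangement V ι) (S : Finset V) (A : Finset (V × ι × V))
    (m : V → ℝ) : Prop where
  isEdge : ∀ e ∈ A, M.IsEdge e
  src_mem : ∀ e ∈ A, e.1 ∈ S
  tgt_mem : ∀ e ∈ A, e.2.2 ∈ S
  not_crosses : ∀ e ∈ A, ∀ g ∈ A, ¬ M.Crosses e g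
  lt_mid : ∀ v, M.X v < m v
  mid_lt : ∀ u v, M.X v < M.X u → m v < M.X u

section Plane

variable {S : Finset V} {A : Finset (V × ι × V)} {m : V → ℝ}

theorem IsPlane.fn_le (hA : IsPlane M S A m) {e g : V × ι × V} (he : e ∈ A) (hg : g ∈ A)
    (h : g.1 = e.1) (hle : M.fn e.2.1 (m e.1) ≤ M.fn g.2.1 (m e.1)) {x : ℝ}
    (h1 : M.X e.1 < x) (h2 : x ≤ M.X e.2.2) (h3 : x ≤ M.X g.2.2) :
    M.fn e.2.1 x ≤ M.fn g.2.1 x := by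
  have he' := hA.isEdge e he
  have hg' := hA.isEdge g hg
  have m1 := hA.lt_mid e.1
  have m2 := hA.mid_lt e.2.2 e.1 he'.2.2.1
  have m3 := hA.mid_lt g.2.2 e.1 (h ▸ hg'.2.2.1)
  rcases eq_or_ne e g with rfl | hne
  · rfl
  have hlt : M.fn e.2.1 (m e.1) < M.fn g.2.1 (m e.1) :=
    lt_of_le_of_ne hle fun heq => hne (he'.eq_of_meet hg' h.symm m1 m2.le m3.le heq)
  exact fn_le_of_lt he' hg' hne (hA.not_crosses e he g hg) m1.le m2.le (h ▸ m1.le) m3.le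
    h1.le h2 (h ▸ h1.le) h3 hlt

theorem IsPlane.exists_isFirst (hA : IsPlane M S A m) {e g : V × ι × V} (he : e ∈ A)
    (hg : M.IsNext A (m e.1) e g) : ∃ w ∈ S, M.IsFirst S e g w := by
  classical
  have he' := hA.isEdge e he
  have hg' := hA.isEdge g hg.1
  have hne : (S.filter (M.InWedge e g)).Nonempty := by
    rcases le_total (M.X e.2.2) (M.X g.2.2) with h | h
    · refine ⟨e.2.2, Finset.mem_filter.2 ⟨hA.tgt_mem e he, he'.2.2.1, le_rfl, h, he'.2.1.2.le, ?_⟩⟩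
      rw [← he'.2.1.2]
      exact hA.fn_le he hg.1 hg.2.1 hg.2.2.1.le he'.2.2.1 le_rfl h
    · have h1 : M.X e.1 < M.X g.2.2 := hg.2.1 ▸ hg'.2.2.1
      refine ⟨g.2.2, Finset.mem_filter.2 ⟨hA.tgt_mem g hg.1, h1, h, le_rfl, ?_, hg'.2.1.2.ge⟩⟩
      rw [← hg'.2.1.2]
      exact hA.fn_le he hg.1 hg.2.1 hg.2.2.1.le h1 h le_rfl
  obtain ⟨w, hw, hmin⟩ := Finset.exists_min_image _ M.X hne
  rw [Finset.mem_filter] at hw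
  exact ⟨w, hw.1, hw.2, fun u hu hu' => hmin u (Finset.mem_filter.2 ⟨hu, hu'⟩)⟩

/-- Wedges whose first point is the same `w` meet only along edges through `w`. -/
theorem IsPlane.incident_of_isFirst (hA : IsPlane M S A m) {e e' g g' : V × ι × V} {w : V}
    (he : e ∈ A) (hg : g ∈ A) (hee : M.IsNext A (m e.1) e e') (hgg : M.IsNext A (m g.1) g g')
    (hew : M.IsFirst S e e' w) (hgw : M.IsFirst S g g' w) (hne : e ≠ g) :
    (M.fn e'.2.1 (M.X w) = M.Y w ∧ M.fn g.2.1 (M.X w) = M.Y w) ∨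
      (M.fn g'.2.1 (M.X w) = M.Y w ∧ M.fn e.2.1 (M.X w) = M.Y w) := by
  wlog hX : M.X e.1 ≤ M.X g.1 generalizing e e' g g'
  · exact (this hg he hgg hee hgw hew hne.symm (le_of_not_ge hX)).symm
  have Ee := hA.isEdge e he
  have Ee' := hA.isEdge e' hee.1
  have Eg := hA.isEdge g hg
  have Eg' := hA.isEdge g' hgg.1
  obtain ⟨⟨we1, we2, we3, we4, we5⟩, we6⟩ := hew
  obtain ⟨⟨wg1, wg2, wg3, wg4, wg5⟩, wg6⟩ := hgw
  suffices h : M.fn e'.2.1 (M.X w) ≤ M.fn g.2.1 (M.X w) ∨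
      M.fn g'.2.1 (M.X w) ≤ M.fn e.2.1 (M.X w) by
    rcases h with h | h
    · left; constructor <;> linarith
    · right; constructor <;> linarith
  by_cases hs : e.1 = g.1
  · have m1 := hA.lt_mid e.1
    have m2 := hA.mid_lt w e.1 we1
    rcases lt_trichotomy (M.fn e.2.1 (m e.1)) (M.fn g.2.1 (m e.1)) with h | h | h
    · left
      have h' := hee.2.2.2 g hg hs.symm h
      rw [← hee.2.1] at h'
      exact hA.fn_le hee.1 hg (hs.symm.trans hee.2.1.symm) h' (hee.2.1 ▸ we1) we3 wg2
    · exact absurd (Ee.eq_of_meet Eg hs m1 (m2.le.trans we2) (m2.le.trans wg2) h) hne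
    · right
      rw [hs] at h
      have h' := hgg.2.2.2 e he hs h
      rw [← hgg.2.1] at h'
      exact hA.fn_le hgg.1 he (hs.trans hgg.2.1.symm) h' (hgg.2.1 ▸ wg1) wg3 we2
  · have hout : M.fn e'.2.1 (M.X g.1) < M.Y g.1 ∨ M.Y g.1 < M.fn e.2.1 (M.X g.1) := by
      rcases hX.lt_or_eq with hlt | heq
      · by_contra! hcon
        have := we6 g.1 (hA.src_mem g hg) ⟨hlt, by linarith, by linarith, hcon.2, hcon.1⟩
        linarith
      · have h1 := Ee.1.2
        have h2 := Ee'.1.2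
        rw [hee.2.1] at h2
        rw [heq] at h1 h2
        rw [h1, h2]
        exact lt_or_gt_of_ne fun h => hs (M.point_ext heq h)
    rcases hout with h | h
    · left
      rw [← Eg.1.2] at h
      have hs' : e'.1 ≠ g.1 := hee.2.1 ▸ hs
      have hX' : M.X e'.1 ≤ M.X g.1 := hee.2.1 ▸ hX
      exact fn_le_of_lt Ee' Eg (fun h => hs' (congrArg Prod.fst h))
        (hA.not_crosses _ hee.1 _ hg) hX' (by linarith) le_rfl (by linarith)
        (by linarith) we3 wg1.le wg2 h
    · right
      have hs' : g'.1 ≠ e.1 := hgg.2.1 ▸ Ne.symm hs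
      have hX' : M.X g'.1 = M.X g.1 := by rw [hgg.2.1]
      have h2 := Eg'.1.2
      rw [hgg.2.1] at h2
      rw [← h2] at h
      exact fn_le_of_lt Eg' Ee (fun h => hs' (congrArg Prod.fst h))
        (hA.not_crosses _ hgg.1 _ he) hX'.le (by linarith) hX (by linarith)
        (by linarith) wg3 (by linarith) we2 h

/-- A graph drawn in the plane without crossings with monotone edges has linearly many edges. -/
theorem IsPlane.card_le (hA : IsPlane M S A m) : A.card ≤ 4 * S.card := by
  classical
  let R : V × ι × V → V × Bool × Bool → Prop := fun e p =>
    (p.2 = (true, true) ∧ p.1 = e.1 ∧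
      ∀ g ∈ A, g.1 = e.1 → M.fn g.2.1 (m e.1) ≤ M.fn e.2.1 (m e.1)) ∨
    ∃ g, M.IsNext A (m e.1) e g ∧ M.IsFirst S e g p.1 ∧
      (p.2.1 = true ↔ M.fn e.2.1 (M.X p.1) = M.Y p.1) ∧
      (p.2.2 = true ↔ M.fn g.2.1 (M.X p.1) = M.Y p.1)
  have not_both : ∀ {e g w}, e ∈ A → M.IsNext A (m e.1) e g → M.IsFirst S e g w →
      M.fn e.2.1 (M.X w) = M.Y w → M.fn g.2.1 (M.X w) = M.Y w → False := by
    intro e g w he hg hw h1 h2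
    have := (hA.isEdge e he).eq_of_meet (hA.isEdge g hg.1) hg.2.1.symm hw.1.1 hw.1.2.1 hw.1.2.2.1
      (h1.trans h2.symm)
    have h3 := hg.2.2.1
    rw [this] at h3
    exact lt_irrefl _ h3
  have hex : ∀ e ∈ A, ∃ p ∈ S ×ˢ (Finset.univ : Finset (Bool × Bool)), R e p := by
    intro e he
    by_cases htop : ∀ g ∈ A, g.1 = e.1 → M.fn g.2.1 (m e.1) ≤ M.fn e.2.1 (m e.1)
    · exact ⟨(e.1, true, true), by simp [hA.src_mem e he], Or.inl ⟨rfl, rfl, htop⟩⟩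
    · push Not at htop
      obtain ⟨g, hg, hge, hlt⟩ := htop
      obtain ⟨g', hg', hmin⟩ := Finset.exists_min_image
        (A.filter fun k => k.1 = e.1 ∧ M.fn e.2.1 (m e.1) < M.fn k.2.1 (m e.1))
        (fun k => M.fn k.2.1 (m e.1)) ⟨g, Finset.mem_filter.2 ⟨hg, hge, hlt⟩⟩
      rw [Finset.mem_filter] at hg'
      have hnext : M.IsNext A (m e.1) e g' := ⟨hg'.1, hg'.2.1, hg'.2.2, fun k hk h1 h2 =>
        hmin k (Finset.mem_filter.2 ⟨hk, h1, h2⟩)⟩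
      obtain ⟨w, hw, hfirst⟩ := hA.exists_isFirst he hnext
      exact ⟨(w, decide (M.fn e.2.1 (M.X w) = M.Y w), decide (M.fn g'.2.1 (M.X w) = M.Y w)),
        by simp [hw], Or.inr ⟨g', hnext, hfirst, by simp, by simp⟩⟩
  rcases A.eq_empty_or_nonempty with rfl | ⟨e₀, -⟩
  · simp
  have : Nonempty V := ⟨e₀.1⟩
  choose! ψ hψS hψ using hex
  have hinj : Set.InjOn ψ (A : Set (V × ι × V)) := by
    intro e he g hg heq
    have h1 := hψ e he
    have h2 := hψ g hg
    rw [← heq] at h2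
    by_contra hne
    rcases h1 with ⟨ht, hs, htop⟩ | ⟨e', hn, hf, hb1, hb2⟩ <;>
      rcases h2 with ⟨ht', hs', htop'⟩ | ⟨g', hn', hf', hb1', hb2'⟩
    · have hs2 : e.1 = g.1 := hs.symm.trans hs'
      have l1 := htop g hg hs2.symm
      have l2 := htop' e he hs2
      rw [← hs2] at l2
      have Ee := hA.isEdge e he
      have Eg := hA.isEdge g hg
      exact hne (Ee.eq_of_meet Eg hs2 (hA.lt_mid _) (hA.mid_lt _ _ Ee.2.2.1).le
        (hA.mid_lt _ _ (hs2 ▸ Eg.2.2.1)).le (le_antisymm l2 l1))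
    · rw [ht] at hb1' hb2'
      exact not_both hg hn' hf' (hb1'.1 rfl) (hb2'.1 rfl)
    · rw [ht'] at hb1 hb2
      exact not_both he hn hf (hb1.1 rfl) (hb2.1 rfl)
    · rcases hA.incident_of_isFirst he hg hn hn' hf hf' hne with ⟨h1, h2⟩ | ⟨h1, h2⟩
      · exact not_both he hn hf (hb1.1 (hb1'.2 h2)) h1
      · exact not_both hg hn' hf' (hb1'.1 (hb1.2 h2)) h1
  calc A.card ≤ (S ×ˢ (Finset.univ : Finset (Bool × Bool))).card :=
        Finset.card_le_card_of_injOn ψ hψS hinj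
    _ = 4 * S.card := by
        rw [Finset.card_product, mul_comm]
        rfl

end Plane

section Counting

open Finset

theorem sum_card_filter_mul_pow {V β : Type*} [Fintype V] [DecidableEq V] (k d : ℕ) [NeZero k]
    (B : Finset β) (T : β → Finset V) (hT : ∀ b ∈ B, (T b).card = d) :
    (∑ c : V → Fin k, (B.filter fun b => ∀ v ∈ T b, c v = 0).card) * k ^ d =
      B.card * k ^ Fintype.card V := by
  have key : ∀ b ∈ B, (univ.filter fun c : V → Fin k => ∀ v ∈ T b, c v = 0).card * k ^ d =
      k ^ Fintype.card V := by
    intro b hb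
    have h1 : (univ.filter fun c : V → Fin k => ∀ v ∈ T b, c v = 0) =
        Fintype.piFinset fun v => if v ∈ T b then {0} else univ := by
      ext c
      simp only [mem_filter, mem_univ, true_and, Fintype.mem_piFinset]
      refine forall_congr' fun v => ?_
      by_cases hv : v ∈ T b <;> simp [hv]
    have h2 : ∀ v, (if v ∈ T b then ({0} : Finset (Fin k)) else univ).card =
        if v ∈ T b then 1 else k := by
      intro v; split_ifs <;> simp
    rw [h1, Fintype.card_piFinset, prod_congr rfl fun v _ => h2 v, ← hT b hb, prod_ite]
    simp only [prod_const, one_pow, one_mul]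
    rw [← pow_add, filter_not, filter_mem_eq_inter, univ_inter, ← compl_eq_univ_sdiff,
      card_compl_add_card]
  simp only [card_filter]
  rw [sum_comm, sum_mul]
  simp only [← card_filter]
  rw [sum_congr rfl key, sum_const, smul_eq_mul]

theorem card_endpoints_eq_four [DecidableEq V] {e g : V × ι × V} (he : M.IsEdge e)
    (hg : M.IsEdge g) (h : M.Crosses e g) :
    ({e.1, e.2.2, g.1, g.2.2} : Finset V).card = 4 := by
  obtain ⟨hne, x, x1, x2, x3, x4, hx⟩ := h
  have h12 : e.1 ≠ e.2.2 := fun h => (h ▸ he.2.2.1).false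
  have h34 : g.1 ≠ g.2.2 := fun h => (h ▸ hg.2.2.1).false
  have h13 : e.1 ≠ g.1 := fun h =>
    hne (congrArg (fun e => e.2.1) (he.eq_of_meet hg h x1 x2.le x4.le hx))
  have h14 : e.1 ≠ g.2.2 := fun h => by rw [h] at x1; linarith
  have h23 : e.2.2 ≠ g.1 := fun h => by rw [h] at x2; linarith
  have h24 : e.2.2 ≠ g.2.2 := fun h => by
    have h5 := hg.2.1.2
    rw [← h] at h5
    exact hne (M.inter (he.mem_dom x1.le x2.le) (hg.mem_dom x3.le x4.le) he.2.1.1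
      (h ▸ hg.2.1.1) x2 hx (he.2.1.2.trans h5.symm))
  rw [card_insert_of_notMem (by simp [*]), card_insert_of_notMem (by simp [*]), card_pair h34]

variable (M) in
theorem exists_mid [Fintype V] (v : V) : ∃ m, M.X v < m ∧ ∀ u, M.X v < M.X u → m < M.X u := by
  classical
  rcases (univ.filter fun u => M.X v < M.X u).eq_empty_or_nonempty with h | h
  · refine ⟨M.X v + 1, by linarith, fun u hu => ?_⟩
    have : u ∈ univ.filter fun u => M.X v < M.X u := by simp [hu]
    simp [h] at this
  · obtain ⟨b, hb, hmin⟩ := exists_min_image _ M.X h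
    rw [mem_filter] at hb
    refine ⟨(M.X v + M.X b) / 2, by linarith, fun u hu => ?_⟩
    have := hmin u (by simp [hu])
    linarith

variable [Fintype V] [Fintype ι] (M)

open Classical in
/-- The finset of all edges. -/
def edges : Finset (V × ι × V) := univ.filter M.IsEdge

open Classical in
/-- The finset of all ordered pairs of crossing edges. -/
def crossings : Finset ((V × ι × V) × (V × ι × V)) :=
  univ.filter fun p => M.IsEdge p.1 ∧ M.IsEdge p.2 ∧ M.Crosses p.1 p.2

variable {M}

theorem mem_edges {e : V × ι × V} : e ∈ M.edges ↔ M.IsEdge e := by simp [edges]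

theorem mem_crossings {p : (V × ι × V) × (V × ι × V)} :
    p ∈ M.crossings ↔ M.IsEdge p.1 ∧ M.IsEdge p.2 ∧ M.Crosses p.1 p.2 := by simp [crossings]

theorem card_crossings_le : M.crossings.card ≤ Fintype.card ι ^ 2 := by
  classical
  rw [sq, ← Fintype.card_prod, ← card_univ]
  refine card_le_card_of_injOn (fun p => (p.1.2.1, p.2.2.1)) (fun _ _ => mem_coe.2 (mem_univ _)) ?_
  rintro ⟨e, g⟩ hp ⟨e', g'⟩ hq heq
  obtain ⟨he, hg, hne, x, x1, x2, x3, x4, hx⟩ := mem_crossings.1 (mem_coe.1 hp)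
  obtain ⟨he', hg', hne', y, y1, y2, y3, y4, hy⟩ := mem_crossings.1 (mem_coe.1 hq)
  simp only [Prod.mk.injEq] at heq x1 x2 x3 x4 y1 y2 y3 y4 hx hy he hg he' hg' hne ⊢
  obtain ⟨hi, hj⟩ := heq
  have dx := he.mem_dom x1.le x2.le
  have dx' := hg.mem_dom x3.le x4.le
  have dy := hi ▸ he'.mem_dom y1.le y2.le
  have dy' := hj ▸ hg'.mem_dom y3.le y4.le
  rw [← hi, ← hj] at hy
  rcases lt_trichotomy x y with h | rfl | h
  · exact absurd (M.inter dx dx' dy dy' h hx hy) hne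
  · exact ⟨he.eq_of_mem he' hi x1 x2 y1 y2, hg.eq_of_mem hg' hj x3 x4 y3 y4⟩
  · exact absurd (M.inter dy dy' dx dx' h hy hx) hne

open Classical in
theorem card_edges_within_le (S : Finset V) :
    (M.edges.filter fun e => ∀ v ∈ ({e.1, e.2.2} : Finset V), v ∈ S).card ≤ 4 * S.card +
      (M.crossings.filter fun p =>
        ∀ v ∈ ({p.1.1, p.1.2.2, p.2.1, p.2.2.2} : Finset V), v ∈ S).card := by
  set A := M.edges.filter fun e => ∀ v ∈ ({e.1, e.2.2} : Finset V), v ∈ S with hAdef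
  set K := M.crossings.filter fun p =>
        ∀ v ∈ ({p.1.1, p.1.2.2, p.2.1, p.2.2.2} : Finset V), v ∈ S with hKdef
  choose m hm1 hm2 using M.exists_mid
  have hsub : ∀ e ∈ A \ K.image Prod.fst, M.IsEdge e ∧ e.1 ∈ S ∧ e.2.2 ∈ S := by
    intro e he
    have := (mem_sdiff.1 he).1
    simpa [hAdef, mem_edges] using this
  have hplane : IsPlane M S (A \ K.image Prod.fst) m :=
    { isEdge := fun e he => (hsub e he).1
      src_mem := fun e he => (hsub e he).2.1
      tgt_mem := fun e he => (hsub e he).2.2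
      not_crosses := by
        intro e he g hg hc
        refine (mem_sdiff.1 he).2 (mem_image.2 ⟨(e, g), mem_filter.2 ⟨mem_crossings.2
          ⟨(hsub e he).1, (hsub g hg).1, hc⟩, ?_⟩, rfl⟩)
        simp [(hsub e he).2, (hsub g hg).2]
      lt_mid := hm1
      mid_lt := fun u v h => hm2 v u h }
  have h1 := hplane.card_le
  have h2 : A.card ≤ (A \ K.image Prod.fst).card + (K.image Prod.fst).card :=
    card_le_card_sdiff_add_card
  have h3 : (K.image Prod.fst).card ≤ K.card := card_image_le
  omega

/-- The crossing inequality, in amplified form. -/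
theorem card_edges_mul_sq_le (k : ℕ) [NeZero k] :
    M.edges.card * k ^ 2 ≤ 4 * Fintype.card V * k ^ 3 + Fintype.card ι ^ 2 := by
  classical
  have hk : 0 < k := Nat.pos_of_ne_zero (NeZero.ne k)
  have h1 := sum_card_filter_mul_pow k 2 M.edges (fun e => {e.1, e.2.2}) fun e he =>
    card_pair fun h => (h ▸ (mem_edges.1 he).2.2.1).false
  have h2 := sum_card_filter_mul_pow k 1 (univ : Finset V) (fun v => {v}) fun v _ =>
    card_singleton v
  have h3 := sum_card_filter_mul_pow k 4 M.crossings
    (fun p => {p.1.1, p.1.2.2, p.2.1, p.2.2.2}) fun p hp =>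
      card_endpoints_eq_four (mem_crossings.1 hp).1 (mem_crossings.1 hp).2.1
        (mem_crossings.1 hp).2.2
  have h4 := sum_le_sum fun (c : V → Fin k) (_ : c ∈ univ) =>
    M.card_edges_within_le (univ.filter fun v => c v = 0)
  simp only [mem_filter, mem_univ, true_and] at h4
  rw [sum_add_distrib, ← mul_sum] at h4
  simp only [mem_singleton, forall_eq] at h2
  rw [card_univ] at h2
  set a := ∑ c : V → Fin k, (M.edges.filter fun e => ∀ v ∈ ({e.1, e.2.2} : Finset V), c v = 0).card
  set b := ∑ c : V → Fin k, (univ.filter fun v => c v = 0).card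
  set d := ∑ c : V → Fin k, (M.crossings.filter fun p =>
    ∀ v ∈ ({p.1.1, p.1.2.2, p.2.1, p.2.2.2} : Finset V), c v = 0).card
  have h5 := card_crossings_le (M := M)
  refine Nat.le_of_mul_le_mul_right ?_ (pow_pos hk (Fintype.card V))
  calc M.edges.card * k ^ 2 * k ^ Fintype.card V = a * k ^ 4 := by
        rw [mul_right_comm, ← h1]; ring
    _ ≤ (4 * b + d) * k ^ 4 := Nat.mul_le_mul_right _ h4
    _ = 4 * (b * k ^ 1) * k ^ 3 + d * k ^ 4 := by ring
    _ = (4 * Fintype.card V * k ^ 3 + M.crossings.card) * k ^ Fintype.card V := by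
        rw [h2, h3]; ring
    _ ≤ _ := by gcongr

open Classical in
theorem card_incidences_le :
    (univ.filter fun p : V × ι => M.Inc p.1 p.2).card ≤ M.edges.card + Fintype.card ι := by
  set L := univ.filter fun p : V × ι => M.Inc p.1 p.2 ∧ ∀ u, M.Inc u p.2 → M.X u ≤ M.X p.1
  have hL : L.card ≤ Fintype.card ι := by
    rw [← card_univ]
    refine card_le_card_of_injOn Prod.snd (fun _ _ => mem_coe.2 (mem_univ _)) ?_
    rintro ⟨u, i⟩ hu ⟨v, j⟩ hv h
    simp only [L, coe_filter, mem_univ, true_and, Set.mem_ofPred_eq] at hu hv h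
    subst h
    rw [hu.1.eq hv.1 (le_antisymm (hv.2 _ hu.1) (hu.2 _ hv.1))]
  have hsub : (univ.filter fun p : V × ι => M.Inc p.1 p.2) ⊆
      M.edges.image (fun e => (e.1, e.2.1)) ∪ L := by
    rintro ⟨a, i⟩ ha
    simp only [mem_filter, mem_univ, true_and] at ha
    rw [mem_union]
    by_cases hlast : ∀ u, M.Inc u i → M.X u ≤ M.X a
    · right
      simp only [L, mem_filter, mem_univ, true_and]
      exact ⟨ha, hlast⟩
    · left
      push Not at hlast
      obtain ⟨u, hu, hau⟩ := hlast
      obtain ⟨b, hb, hmin⟩ := exists_min_image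
        (univ.filter fun u => M.Inc u i ∧ M.X a < M.X u) M.X ⟨u, by simp [hu, hau]⟩
      simp only [mem_filter, mem_univ, true_and] at hb hmin
      exact mem_image.2 ⟨(a, i, b), mem_edges.2 ⟨ha, hb.1, hb.2, fun v h1 h2 => hmin v ⟨h1, h2⟩⟩,
        rfl⟩
  calc _ ≤ _ := card_le_card hsub
    _ ≤ _ := card_union_le _ _
    _ ≤ _ := add_le_add card_image_le hL

open Classical in
/-- The Szemerédi–Trotter bound for `n` points and `n` curves. -/
theorem card_incidences_le_rpow {n : ℕ} (hn : 0 < n) (hV : Fintype.card V ≤ n)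
    (hι : Fintype.card ι ≤ n) :
    ((univ.filter fun p : V × ι => M.Inc p.1 p.2).card : ℝ) ≤ 10 * (n : ℝ) ^ (4 / 3 : ℝ) := by
  have hn1 : (1 : ℝ) ≤ n := by exact_mod_cast hn
  set r : ℝ := (n : ℝ) ^ (1 / 3 : ℝ) with hr
  have hr1 : 1 ≤ r := Real.one_le_rpow hn1 (by norm_num)
  have hr3 : r ^ 3 = n := by
    rw [hr, ← Real.rpow_natCast, ← Real.rpow_mul (by positivity)]
    norm_num
  have hr4 : (n : ℝ) ^ (4 / 3 : ℝ) = r ^ 4 := by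
    rw [hr, ← Real.rpow_natCast, ← Real.rpow_mul (by positivity)]
    norm_num
  set k := ⌈r⌉₊ with hk
  have hk1 : r ≤ k := Nat.le_ceil r
  have hk2 : (k : ℝ) ≤ 2 * r := by
    have := (Nat.ceil_lt_add_one (by linarith : 0 ≤ r)).le
    linarith
  have : NeZero k := ⟨by rintro h; rw [h] at hk1; norm_num at hk1; linarith⟩
  have h1 : (M.edges.card : ℝ) * k ^ 2 ≤ 4 * n * k ^ 3 + n ^ 2 := by
    have h : M.edges.card * k ^ 2 ≤ 4 * n * k ^ 3 + n ^ 2 :=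
      (M.card_edges_mul_sq_le k).trans (by gcongr)
    exact_mod_cast h
  have h2 : ((univ.filter fun p : V × ι => M.Inc p.1 p.2).card : ℝ) ≤ M.edges.card + n := by
    exact_mod_cast M.card_incidences_le.trans (by gcongr)
  have h3 : (M.edges.card : ℝ) ≤ 9 * r ^ 4 := by
    have hkpos : (0 : ℝ) < k := by linarith
    refine le_of_mul_le_mul_right (a := (k : ℝ) ^ 2) (h1.trans ?_) (by positivity)
    rw [← hr3]
    have e1 : 4 * r ^ 3 * (k : ℝ) ^ 3 ≤ 4 * r ^ 3 * (2 * r * k ^ 2) := by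
      have : (k : ℝ) ^ 3 ≤ 2 * r * k ^ 2 := by
        rw [pow_succ' (k : ℝ) 2]; gcongr
      gcongr
    have e2 : (r ^ 3) ^ 2 ≤ r ^ 4 * (k : ℝ) ^ 2 := by
      calc (r ^ 3) ^ 2 = r ^ 4 * r ^ 2 := by ring
        _ ≤ _ := by gcongr
    nlinarith
  have h4 : (n : ℝ) ≤ r ^ 4 := by
    rw [← hr3]
    exact pow_le_pow_right₀ hr1 (by norm_num)
  rw [hr4]
  linarith

end Counting

end MonotoneArrangement

section Geometry

open Finset

theorem semicircle_inter {r a b c d x y p p' q q' : ℝ} (hxy : x < y)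
    (hp : p ^ 2 = r ^ 2 - (x - a) ^ 2) (hp' : p' ^ 2 = r ^ 2 - (x - c) ^ 2)
    (hq : q ^ 2 = r ^ 2 - (y - a) ^ 2) (hq' : q' ^ 2 = r ^ 2 - (y - c) ^ 2)
    (p0 : 0 ≤ p) (p0' : 0 ≤ p') (q0 : 0 ≤ q) (q0' : 0 ≤ q')
    (hx : b + p = d + p') (hy : b + q = d + q') : a = c ∧ b = d := by
  suffices h : a = c by
    subst h
    have h2 : p = p' := (pow_left_inj₀ p0 p0' two_ne_zero).1 (hp.trans hp'.symm)
    exact ⟨rfl, by linarith⟩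
  have hs : p - q = p' - q' := by linarith
  have e1 : (p - q) * (p + q) = (y - x) * (x + y - 2 * a) := by linear_combination hp - hq
  have e2 : (p - q) * (p' + q') = (y - x) * (x + y - 2 * c) := by
    rw [hs]; linear_combination hp' - hq'
  have hD : y - x ≠ 0 := by linarith
  by_cases h0 : p - q = 0
  · rw [h0, zero_mul] at e1 e2
    have h1 := (mul_eq_zero.1 e1.symm).resolve_left hD
    have h2 := (mul_eq_zero.1 e2.symm).resolve_left hD
    linarith
  have e3 : (p + q) ^ 2 + (x + y - 2 * a) ^ 2 = (p' + q') ^ 2 + (x + y - 2 * c) ^ 2 := by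
    linear_combination 2 * hp + 2 * hq - 2 * hp' - 2 * hq' - (p - q + p' - q') * hs
  have e4 : ((p - q) ^ 2 + (y - x) ^ 2) * ((x + y - 2 * a) ^ 2 - (x + y - 2 * c) ^ 2) = 0 := by
    linear_combination (p - q) ^ 2 * e3 -
      ((p - q) * (p + q) + (y - x) * (x + y - 2 * a)) * e1 +
      ((p - q) * (p' + q') + (y - x) * (x + y - 2 * c)) * e2
  have h5 : (p - q) ^ 2 + (y - x) ^ 2 ≠ 0 := by positivity
  have e5 := sub_eq_zero.1 ((mul_eq_zero.1 e4).resolve_left h5)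
  rcases sq_eq_sq_iff_eq_or_eq_neg.1 e5 with h | h
  · linarith
  · have h6 : (p - q) * (p + q + p' + q') = 0 := by linear_combination e1 + e2 + (y - x) * h
    have h7 := (mul_eq_zero.1 h6).resolve_left h0
    have h8 : p + q = 0 := by linarith
    rw [h8, mul_zero] at e1
    have h9 := (mul_eq_zero.1 e1.symm).resolve_left hD
    linarith

theorem norm_sub_eq_iff {u v : Pt2} {r : ℝ} (hr : 0 < r) :
    ‖u - v‖ = r ↔ (u 0 - v 0) ^ 2 + (u 1 - v 1) ^ 2 = r ^ 2 := by
  rw [← pow_left_inj₀ (norm_nonneg _) hr.le two_ne_zero, EuclideanSpace.real_norm_sq_eq]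
  simp [Fin.sum_univ_two]

theorem inner_eq (u v : Pt2) : ⟪u, v⟫_ℝ = u 0 * v 0 + u 1 * v 1 := by
  simp [PiLp.inner_apply, Fin.sum_univ_two, mul_comm]

theorem Pt2.ext {u v : Pt2} (h0 : u 0 = v 0) (h1 : u 1 = v 1) : u = v := by
  ext i
  fin_cases i
  · exact h0
  · exact h1

/-- The points of `E` and the upper halves of the circles of radius `r` centred at them. -/
def semicircles (E : Finset Pt2) (r : ℝ) : MonotoneArrangement E E where
  X v := v.1 0
  Y v := v.1 1
  point_ext h0 h1 := Subtype.ext (Pt2.ext h0 h1)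
  dom u := Set.Icc (u.1 0 - r) (u.1 0 + r)
  fn u x := u.1 1 + √(r ^ 2 - (x - u.1 0) ^ 2)
  ordConnected _ := Set.ordConnected_Icc
  cont _ := by fun_prop
  inter := by
    intro u v x y hxu hxv hyu hyv hxy hx hy
    have key : ∀ {z c : ℝ}, z ∈ Set.Icc (c - r) (c + r) →
        √(r ^ 2 - (z - c) ^ 2) ^ 2 = r ^ 2 - (z - c) ^ 2 := by
      intro z c hz
      refine Real.sq_sqrt ?_
      nlinarith [hz.1, hz.2]
    obtain ⟨h0, h1⟩ := semicircle_inter hxy (key hxu) (key hxv) (key hyu) (key hyv)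
      (Real.sqrt_nonneg _) (Real.sqrt_nonneg _) (Real.sqrt_nonneg _) (Real.sqrt_nonneg _) hx hy
    exact Subtype.ext (Pt2.ext h0 h1)

/-- The points of `E` and the nonvertical lines dual to them under the dot product. -/
def dualLines (E : Finset Pt2) {r : ℝ} (hr : r ≠ 0) :
    MonotoneArrangement E {u : E // u.1 1 ≠ 0} where
  X v := v.1 0
  Y v := v.1 1
  point_ext h0 h1 := Subtype.ext (Pt2.ext h0 h1)
  dom _ := Set.univ
  fn u x := (r - u.1.1 0 * x) / u.1.1 1
  ordConnected _ := Set.ordConnected_univ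
  cont _ := by fun_prop
  inter := by
    rintro ⟨u, hu⟩ ⟨v, hv⟩ x y - - - - hxy hx hy
    rw [div_eq_div_iff hu hv] at hx hy
    have h1 : (y - x) * (u.1 0 * v.1 1 - v.1 0 * u.1 1) = 0 := by linear_combination hx - hy
    have h2 := (mul_eq_zero.1 h1).resolve_left (by linarith)
    have h3 : r * (u.1 1 - v.1 1) = 0 := by linear_combination -hx - x * h2
    have h4 := sub_eq_zero.1 ((mul_eq_zero.1 h3).resolve_left hr)
    rw [← h4, ← sub_mul] at h2
    have h5 := sub_eq_zero.1 ((mul_eq_zero.1 h2).resolve_right hu)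
    exact Subtype.ext (Subtype.ext (Pt2.ext h5 h4))

open Classical in
/-- The number of pairs of points at a given distance. -/
theorem card_dist_pairs_le {E : Finset Pt2} (hE : 0 < E.card) {r : ℝ} (hr : 0 < r) :
    (((E ×ˢ E).filter fun p => ‖p.1 - p.2‖ = r).card : ℝ) ≤
      20 * (E.card : ℝ) ^ (4 / 3 : ℝ) := by
  set U := (E ×ˢ E).filter fun p => ‖p.1 - p.2‖ = r ∧ p.1 1 ≤ p.2 1 with hU
  set J := univ.filter fun p : E × E => (semicircles E r).Inc p.1 p.2 with hJ
  have hJc : (J.card : ℝ) ≤ 10 * (E.card : ℝ) ^ (4 / 3 : ℝ) :=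
    MonotoneArrangement.card_incidences_le_rpow hE (by simp) (by simp)
  have hUJ : U ⊆ J.image fun q => (q.2.1, q.1.1) := by
    rintro ⟨u, v⟩ h
    simp only [hU, mem_filter, mem_product, norm_sub_eq_iff hr] at h
    obtain ⟨⟨hu, hv⟩, h1, h2⟩ := h
    refine mem_image.2 ⟨(⟨v, hv⟩, ⟨u, hu⟩), mem_filter.2 ⟨mem_univ _, ?_, ?_⟩, rfl⟩
    · have : |v 0 - u 0| ≤ r := abs_le_of_sq_le_sq (by nlinarith [sq_nonneg (u 1 - v 1)]) hr.le
      rw [abs_le] at this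
      constructor <;> simp only [semicircles] <;> linarith
    · simp only [semicircles]
      rw [show r ^ 2 - (v 0 - u 0) ^ 2 = (v 1 - u 1) ^ 2 by linear_combination -h1,
        Real.sqrt_sq (by linarith)]
      ring
  have hsub : ((E ×ˢ E).filter fun p => ‖p.1 - p.2‖ = r) ⊆ U ∪ U.image Prod.swap := by
    rintro ⟨u, v⟩ h
    simp only [mem_filter, mem_product] at h
    rw [mem_union]
    rcases le_total (u 1) (v 1) with h' | h'
    · left
      exact mem_filter.2 ⟨mem_product.2 h.1, h.2, h'⟩
    · right
      refine mem_image.2 ⟨(v, u), mem_filter.2 ⟨mem_product.2 h.1.symm, ?_, h'⟩, rfl⟩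
      rw [norm_sub_rev]
      exact h.2
  have h1 : ((E ×ˢ E).filter fun p => ‖p.1 - p.2‖ = r).card ≤ J.card + J.card :=
    (card_le_card hsub).trans <| (card_union_le _ _).trans <|
      add_le_add ((card_le_card hUJ).trans card_image_le)
        (card_image_le.trans ((card_le_card hUJ).trans card_image_le))
  have h2 : (((E ×ˢ E).filter fun p => ‖p.1 - p.2‖ = r).card : ℝ) ≤ J.card + J.card := by
    exact_mod_cast h1
  linarith

open Classical in
/-- The number of pairs of points with a given nonzero dot product. -/
theorem card_inner_pairs_le {E : Finset Pt2} (hE : 0 < E.card) {r : ℝ} (hr : r ≠ 0) :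
    (((E ×ˢ E).filter fun p => ⟪p.1, p.2⟫_ℝ = r).card : ℝ) ≤
      20 * (E.card : ℝ) ^ (4 / 3 : ℝ) := by
  set U := (E ×ˢ E).filter fun p => ⟪p.1, p.2⟫_ℝ = r ∧ p.1 1 = 0 with hU
  set J := univ.filter fun p : E × {u : E // u.1 1 ≠ 0} => (dualLines E hr).Inc p.1 p.2 with hJ
  have hJc : (J.card : ℝ) ≤ 10 * (E.card : ℝ) ^ (4 / 3 : ℝ) :=
    MonotoneArrangement.card_incidences_le_rpow hE (by simp)
      ((Fintype.card_subtype_le _).trans (by simp))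
  have hUc : U.card ≤ E.card := by
    refine card_le_card_of_injOn Prod.snd
      (fun p hp => (mem_product.1 (mem_filter.1 hp).1).2) ?_
    rintro ⟨u, v⟩ hp ⟨u', v'⟩ hq h
    simp only [hU, coe_filter, Set.mem_ofPred_eq, inner_eq] at hp hq h
    obtain ⟨-, hp1, hp2⟩ := hp
    obtain ⟨-, hq1, hq2⟩ := hq
    subst h
    rw [hp2, zero_mul, add_zero] at hp1
    rw [hq2, zero_mul, add_zero] at hq1
    have hv : v 0 ≠ 0 := fun h => hr (by rw [← hp1, h, mul_zero])
    rw [Pt2.ext (mul_right_cancel₀ hv (hp1.trans hq1.symm)) (hp2.trans hq2.symm)]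
  have hsub : ((E ×ˢ E).filter fun p => ⟪p.1, p.2⟫_ℝ = r) ⊆
      J.image (fun q => (q.2.1.1, q.1.1)) ∪ U := by
    rintro ⟨u, v⟩ h
    simp only [mem_filter, mem_product] at h
    obtain ⟨⟨hu, hv⟩, h1⟩ := h
    rw [mem_union]
    by_cases h0 : u 1 = 0
    · exact Or.inr (mem_filter.2 ⟨mem_product.2 ⟨hu, hv⟩, h1, h0⟩)
    · refine Or.inl (mem_image.2 ⟨(⟨v, hv⟩, ⟨⟨u, hu⟩, h0⟩), mem_filter.2 ⟨mem_univ _,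
        Set.mem_univ _, ?_⟩, rfl⟩)
      rw [inner_eq] at h1
      simp only [dualLines]
      rw [div_eq_iff h0]
      linarith
  have h1 : ((E ×ˢ E).filter fun p => ⟪p.1, p.2⟫_ℝ = r).card ≤ J.card + E.card :=
    (card_le_card hsub).trans <| (card_union_le _ _).trans <| add_le_add card_image_le hUc
  have h2 : (((E ×ˢ E).filter fun p => ⟪p.1, p.2⟫_ℝ = r).card : ℝ) ≤ J.card + E.card := by
    exact_mod_cast h1
  have hn1 : (1 : ℝ) ≤ E.card := by exact_mod_cast hE
  have h3 := Real.rpow_le_rpow_of_exponent_le hn1 (by norm_num : (1 : ℝ) ≤ 4 / 3)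
  rw [Real.rpow_one] at h3
  linarith

open Classical in
/-- The number of triples of points `(x, y, z)` with `x ≠ z` and given distances from `y` to `x`
and `z`. -/
theorem card_dist_triples_le (E : Finset Pt2) (a b : ℝ) :
    ((E ×ˢ E ×ˢ E).filter fun p => p.1 ≠ p.2.2 ∧ ‖p.1 - p.2.1‖ = a ∧ ‖p.2.1 - p.2.2‖ = b).card ≤
      2 * E.card ^ 2 := by
  set T := (E ×ˢ E ×ˢ E).filter fun p =>
    p.1 ≠ p.2.2 ∧ ‖p.1 - p.2.1‖ = a ∧ ‖p.2.1 - p.2.2‖ = b with hT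
  have h1 : T.card ≤ 2 * (T.image fun p => (p.1, p.2.2)).card := by
    refine card_le_mul_card_image _ _ ?_
    rintro ⟨x, z⟩ -
    by_contra! hlt
    obtain ⟨p, q, r, hp, hq, hr, hpq, hpr, hqr⟩ := two_lt_card_iff.1 hlt
    obtain ⟨p1, p, p2⟩ := p
    obtain ⟨q1, q, q2⟩ := q
    obtain ⟨r1, r, r2⟩ := r
    simp only [hT, mem_filter, Prod.mk.injEq] at hp hq hr
    obtain ⟨⟨-, hxz, hp1, hp2⟩, rfl, rfl⟩ := hp
    obtain ⟨⟨-, -, hq1, hq2⟩, rfl, rfl⟩ := hq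
    obtain ⟨⟨-, -, hr1, hr2⟩, rfl, rfl⟩ := hr
    rw [← dist_eq_norm, dist_comm] at hp1 hq1 hr1
    rw [← dist_eq_norm] at hp2 hq2 hr2
    have : Fact (Module.finrank ℝ Pt2 = 2) := ⟨by simp⟩
    rcases EuclideanGeometry.eq_of_dist_eq_of_dist_eq_of_finrank_eq_two (V := Pt2) (by simp) hxz
      (fun h => hpq (by rw [h])) hp1 hq1 hr1 hp2 hq2 hr2 with h | h
    · exact hpr (by rw [h])
    · exact hqr (by rw [h])
  have h2 : (T.image fun p => (p.1, p.2.2)).card ≤ E.card ^ 2 := by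
    rw [sq, ← card_product]
    refine card_le_card fun q hq => ?_
    obtain ⟨p, hp, rfl⟩ := mem_image.1 hq
    have := (mem_filter.1 hp).1
    simp only [mem_product] at this ⊢
    exact ⟨this.1, this.2.2⟩
  omega

open Classical in
/-- The number of triples of points `(x, y, z)` with `x ≠ z` and given dot products of `y`
with `x` and `z`, the first of them nonzero. -/
theorem card_inner_triples_le (E : Finset Pt2) {a : ℝ} (b : ℝ) (ha : a ≠ 0) :
    ((E ×ˢ E ×ˢ E).filter fun p =>
      p.1 ≠ p.2.2 ∧ ⟪p.1, p.2.1⟫_ℝ = a ∧ ⟪p.2.1, p.2.2⟫_ℝ = b).card ≤ 2 * E.card ^ 2 := by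
  set T := (E ×ˢ E ×ˢ E).filter fun p =>
    p.1 ≠ p.2.2 ∧ ⟪p.1, p.2.1⟫_ℝ = a ∧ ⟪p.2.1, p.2.2⟫_ℝ = b with hT
  have h1 : (T.filter fun p => p.1 0 * p.2.2 1 = p.1 1 * p.2.2 0).card ≤ E.card ^ 2 := by
    rw [sq, ← card_product]
    refine card_le_card_of_injOn (fun p => (p.1, p.2.1)) ?_ ?_
    · intro p hp
      have := (mem_filter.1 (mem_filter.1 hp).1).1
      simp only [mem_product, coe_product, Set.mem_prod, mem_coe] at this ⊢
      exact ⟨this.1, this.2.1⟩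
    · rintro ⟨x, y, z⟩ hp ⟨x', y', z'⟩ hq h
      simp only [hT, coe_filter, mem_filter, Set.mem_ofPred_eq, inner_eq, Prod.mk.injEq]
        at hp hq h ⊢
      obtain ⟨⟨-, -, ha1, hb1⟩, hpar⟩ := hp
      obtain ⟨⟨-, -, -, hb2⟩, hpar'⟩ := hq
      obtain ⟨rfl, rfl⟩ := h
      refine ⟨rfl, rfl, Pt2.ext ?_ ?_⟩
      · refine mul_left_cancel₀ ha ?_
        linear_combination (-z 0 + z' 0) * ha1 + x 0 * hb1 - x 0 * hb2 - y 1 * hpar + y 1 * hpar'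
      · refine mul_left_cancel₀ ha ?_
        linear_combination (-z 1 + z' 1) * ha1 + x 1 * hb1 - x 1 * hb2 + y 0 * hpar - y 0 * hpar'
  have h2 : (T.filter fun p => ¬ p.1 0 * p.2.2 1 = p.1 1 * p.2.2 0).card ≤ E.card ^ 2 := by
    rw [sq, ← card_product]
    refine card_le_card_of_injOn (fun p => (p.1, p.2.2)) ?_ ?_
    · intro p hp
      have := (mem_filter.1 (mem_filter.1 hp).1).1
      simp only [mem_product, coe_product, Set.mem_prod, mem_coe] at this ⊢
      exact ⟨this.1, this.2.2⟩
    · rintro ⟨x, y, z⟩ hp ⟨x', y', z'⟩ hq h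
      simp only [hT, coe_filter, mem_filter, Set.mem_ofPred_eq, inner_eq, Prod.mk.injEq]
        at hp hq h ⊢
      obtain ⟨⟨-, -, ha1, hb1⟩, hpar⟩ := hp
      obtain ⟨⟨-, -, ha2, hb2⟩, -⟩ := hq
      obtain ⟨rfl, rfl⟩ := h
      refine ⟨rfl, Pt2.ext ?_ ?_, rfl⟩
      · refine mul_left_cancel₀ (sub_ne_zero.2 hpar) ?_
        linear_combination z 1 * (ha1 - ha2) - x 1 * (hb1 - hb2)
      · refine mul_left_cancel₀ (sub_ne_zero.2 hpar) ?_
        linear_combination -z 0 * (ha1 - ha2) + x 0 * (hb1 - hb2)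
  have h3 := card_filter_add_card_filter_not (s := T)
    fun p => p.1 0 * p.2.2 1 = p.1 1 * p.2.2 0
  omega

/-- Configurations are determined by their restrictions to the pieces of the cover and to the
uncovered vertices. -/
theorem ncard_le_prod_of_cover {V : Type*} [Fintype V] {s t : ℕ}
    {F : (Fin s × Fin 2) ⊕ (Fin t × Fin 3) → V} (hF : Function.Injective F) {E : Finset Pt2}
    {S : Set (V → Pt2)} (hS : ∀ φ ∈ S, ∀ v, φ v ∈ E)
    (Q : Fin s → Finset (Pt2 × Pt2)) (T : Fin t → Finset (Pt2 × Pt2 × Pt2))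
    (hQ : ∀ φ ∈ S, ∀ i, (φ (F (.inl (i, 0))), φ (F (.inl (i, 1)))) ∈ Q i)
    (hT : ∀ φ ∈ S, ∀ j,
      (φ (F (.inr (j, 0))), φ (F (.inr (j, 1))), φ (F (.inr (j, 2)))) ∈ T j) :
    S.ncard ≤ (∏ i, (Q i).card) * ((∏ j, (T j).card) *
      E.card ^ (Fintype.card V - (2 * s + 3 * t))) := by
  classical
  let Z := {v // ¬ v ∈ Set.range F}
  let B : Finset ((Fin s → Pt2 × Pt2) × (Fin t → Pt2 × Pt2 × Pt2) × (Z → Pt2)) :=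
    Fintype.piFinset Q ×ˢ Fintype.piFinset T ×ˢ Fintype.piFinset fun _ => E
  let Φ : (V → Pt2) → (Fin s → Pt2 × Pt2) × (Fin t → Pt2 × Pt2 × Pt2) × (Z → Pt2) := fun φ =>
    (fun i => (φ (F (.inl (i, 0))), φ (F (.inl (i, 1)))),
      fun j => (φ (F (.inr (j, 0))), φ (F (.inr (j, 1))), φ (F (.inr (j, 2)))), fun v => φ v)
  have hle : S.ncard ≤ B.card := by
    rw [← Set.ncard_coe_finset]
    refine Set.ncard_le_ncard_of_injOn Φ (fun φ hφ => ?_) ?_ (Finset.finite_toSet _)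
    · simp only [B, Φ, coe_product, Set.mem_prod, mem_coe, Fintype.mem_piFinset]
      exact ⟨hQ φ hφ, hT φ hφ, fun v => hS φ hφ v⟩
    · rintro φ - ψ - h
      simp only [Φ, Prod.mk.injEq, funext_iff] at h
      obtain ⟨h1, h2, h3⟩ := h
      ext1 v
      by_cases hv : v ∈ Set.range F
      · obtain ⟨(⟨i, k⟩ | ⟨j, k⟩), rfl⟩ := hv
        · fin_cases k
          · exact (h1 i).1
          · exact (h1 i).2
        · fin_cases k
          · exact (h2 j).1
          · exact (h2 j).2.1
          · exact (h2 j).2.2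
      · exact h3 ⟨v, hv⟩
  have hZ : Fintype.card Z = Fintype.card V - (2 * s + 3 * t) := by
    have hF' : Fintype.card {v // v ∈ Set.range F} = 2 * s + 3 * t := by
      rw [← Fintype.card_congr (Equiv.ofInjective F hF)]
      simp [mul_comm]
    rw [Fintype.card_subtype_compl, hF']
  refine hle.trans_eq ?_
  simp only [B, card_product, Fintype.card_piFinset, prod_const, card_univ, hZ]

/-- The bound on configurations from bounds on the pairs and triples in the cover. -/
theorem ncard_le_of_cover {V : Type*} [Fintype V] {s t : ℕ}
    {F : (Fin s × Fin 2) ⊕ (Fin t × Fin 3) → V} (hF : Function.Injective F) {E : Finset Pt2}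
    (hE : 0 < E.card) {S : Set (V → Pt2)} (hS : ∀ φ ∈ S, ∀ v, φ v ∈ E)
    (Q : Fin s → Finset (Pt2 × Pt2)) (T : Fin t → Finset (Pt2 × Pt2 × Pt2))
    (hQ : ∀ φ ∈ S, ∀ i, (φ (F (.inl (i, 0))), φ (F (.inl (i, 1)))) ∈ Q i)
    (hT : ∀ φ ∈ S, ∀ j,
      (φ (F (.inr (j, 0))), φ (F (.inr (j, 1))), φ (F (.inr (j, 2)))) ∈ T j)
    (hQc : ∀ i, ((Q i).card : ℝ) ≤ 20 * (E.card : ℝ) ^ (4 / 3 : ℝ))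
    (hTc : ∀ j, (T j).card ≤ 2 * E.card ^ 2) :
    (S.ncard : ℝ) ≤ 20 ^ s * 2 ^ t * (E.card : ℝ) ^ ((4 : ℝ) / 3 * s + 2 * t +
      ((Fintype.card V - (2 * s + 3 * t) : ℕ) : ℝ)) := by
  have hle := ncard_le_prod_of_cover hF hS Q T hQ hT
  have hn : (0 : ℝ) < E.card := by exact_mod_cast hE
  have h1 : ∏ i, ((Q i).card : ℝ) ≤ (20 * (E.card : ℝ) ^ (4 / 3 : ℝ)) ^ s := by
    simpa using prod_le_prod (fun i _ => Nat.cast_nonneg _) fun i (_ : i ∈ univ) => hQc i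
  have h2 : ∏ j, ((T j).card : ℝ) ≤ (2 * (E.card : ℝ) ^ 2) ^ t := by
    simpa using prod_le_prod (fun j _ => Nat.cast_nonneg _) fun j (_ : j ∈ univ) =>
      show ((T j).card : ℝ) ≤ 2 * (E.card : ℝ) ^ 2 by exact_mod_cast hTc j
  calc (S.ncard : ℝ) ≤ (∏ i, ((Q i).card : ℝ)) * ((∏ j, ((T j).card : ℝ)) *
        (E.card : ℝ) ^ (Fintype.card V - (2 * s + 3 * t))) := by exact_mod_cast hle
    _ ≤ (20 * (E.card : ℝ) ^ (4 / 3 : ℝ)) ^ s * ((2 * (E.card : ℝ) ^ 2) ^ t *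
        (E.card : ℝ) ^ (Fintype.card V - (2 * s + 3 * t))) := by gcongr
    _ = _ := by
      rw [Real.rpow_add hn, Real.rpow_add hn, Real.rpow_mul hn.le, Real.rpow_mul hn.le,
        Real.rpow_natCast, Real.rpow_natCast, Real.rpow_natCast, Real.rpow_two, mul_pow, mul_pow]
      ring

end Geometry

/-- **covering a subgraph and counting the remaining vertices crudely.**
Let `G` be a finite edge-weighted graph and let `H` be a subgraph of `G` that can be
`(s, t)`-covered; we encode the `(s, t)`-cover of `H` as an injective map `F` from
`Fin s × Fin 2 ⊕ Fin t × Fin 3` into the vertices of `G` whose image is `V(H)` and whose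
paths run along edges of `G` (the edges of `H` being edges of `G`), so that
`|V(G) \ V(H)| = |V(G)| − (2s + 3t)`.  If all edge weights of `G` are positive then
`f(G; n) ≲ n^((4/3)s + 2t + |V(G) \ V(H)|)`, and if all edge weights of `G` are nonzero
then `g(G; n) ≲ n^((4/3)s + 2t + |V(G) \ V(H)|)`. -/
theorem subgraph_cover_bounds {V : Type*} [Fintype V] (G : SimpleGraph V) (w : V → V → ℝ)
    (hsym : ∀ u v, w u v = w v u) (s t : ℕ)
    (F : (Fin s × Fin 2) ⊕ (Fin t × Fin 3) → V) (hF : Function.Injective F)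
    (hP2 : ∀ i : Fin s, G.Adj (F (Sum.inl (i, 0))) (F (Sum.inl (i, 1))))
    (hP3 : ∀ j : Fin t, G.Adj (F (Sum.inr (j, 0))) (F (Sum.inr (j, 1))) ∧
      G.Adj (F (Sum.inr (j, 1))) (F (Sum.inr (j, 2)))) :
    ((∀ u v, G.Adj u v → 0 < w u v) →
      ∃ C : ℝ, 0 < C ∧ ∃ N : ℕ, ∀ n : ℕ, N < n → ∀ E : Finset Pt2, E.card = n →
        ((distConfigs G w E).ncard : ℝ) ≤
          C * (n : ℝ) ^ ((4 : ℝ) / 3 * s + 2 * t +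
            ((Fintype.card V - (2 * s + 3 * t) : ℕ) : ℝ))) ∧
    ((∀ u v, G.Adj u v → w u v ≠ 0) →
      ∃ C : ℝ, 0 < C ∧ ∃ N : ℕ, ∀ n : ℕ, N < n → ∀ E : Finset Pt2, E.card = n →
        ((dpConfigs G w E).ncard : ℝ) ≤
          C * (n : ℝ) ^ ((4 : ℝ) / 3 * s + 2 * t +
            ((Fintype.card V - (2 * s + 3 * t) : ℕ) : ℝ))) := by
  classical
  constructor
  · intro hw
    refine ⟨20 ^ s * 2 ^ t, by positivity, 0, ?_⟩
    rintro _ hn E rfl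
    refine ncard_le_of_cover hF hn (fun φ hφ => hφ.1) _ _ (fun φ hφ i => ?_) (fun φ hφ j => ?_)
      (fun i => card_dist_pairs_le hn (hw _ _ (hP2 i)))
      (fun j => card_dist_triples_le E (w (F (.inr (j, 0))) (F (.inr (j, 1))))
        (w (F (.inr (j, 1))) (F (.inr (j, 2)))))
    · exact Finset.mem_filter.2 ⟨Finset.mem_product.2 ⟨hφ.1 _, hφ.1 _⟩, hφ.2.2 _ _ (hP2 i)⟩
    · exact Finset.mem_filter.2 ⟨by simp [hφ.1], by simp [hφ.2.1.eq_iff, hF.eq_iff],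
        hφ.2.2 _ _ (hP3 j).1, hφ.2.2 _ _ (hP3 j).2⟩
  · intro hw
    refine ⟨20 ^ s * 2 ^ t, by positivity, 0, ?_⟩
    rintro _ hn E rfl
    refine ncard_le_of_cover hF hn (fun φ hφ => hφ.1) _ _ (fun φ hφ i => ?_) (fun φ hφ j => ?_)
      (fun i => card_inner_pairs_le hn (hw _ _ (hP2 i)))
      (fun j => card_inner_triples_le E (w (F (.inr (j, 1))) (F (.inr (j, 2)))) (hw _ _ (hP3 j).1))
    · exact Finset.mem_filter.2 ⟨Finset.mem_product.2 ⟨hφ.1 _, hφ.1 _⟩, hφ.2.2 _ _ (hP2 i)⟩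
    · exact Finset.mem_filter.2 ⟨by simp [hφ.1], by simp [hφ.2.1.eq_iff, hF.eq_iff],
        hφ.2.2 _ _ (hP3 j).1, hφ.2.2 _ _ (hP3 j).2⟩
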